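/- Let Q be an n×n Hermitian positive definite matrix written as Q = UDU*, where U is unitary and D is diagonal with positive diagonal entries, and let D^{1/2} be the positive diagonal square root of D with inverse D^{-1/2}. Let A be an m×n matrix and b ∈ ℂ^m such that the set S = {x ∈ ℂ^n : Ax = b} is nonempty. Then the problem of minimizing the quadratic form ⟨x, Qx⟩ over x ∈ S has the unique solution x = U D^{-1/2} (A U D^{-1/2})† b, where (·)† denotes the Moore-Penrose inverse. -/

import Mathlib

open scoped ComplexOrder Matrix

/-- `Md` is the Moore–Penrose inverse of the matrix `M`:
it satisfies the four Penrose equations. -/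
def Matrix.IsMoorePenroseInverse {m n : ℕ}
    (M : Matrix (Fin m) (Fin n) ℂ) (Md : Matrix (Fin n) (Fin m) ℂ) : Prop :=
  (M * Md)ᴴ = M * Md ∧ (Md * M)ᴴ = Md * M ∧ M * Md * M = M ∧ Md * M * Md = Md

theorem proj_aux {n : ℕ} (P : Matrix (Fin n) (Fin n) ℂ) (h1 : Pᴴ = P) (h2 : P * P = P)
    (y z : Fin n → ℂ) (hz : P.mulVec y = z) (hne : y ≠ z) :
    (star z ⬝ᵥ z).re < (star y ⬝ᵥ y).re := by
  have a : ∀ v, star z ⬝ᵥ v = star y ⬝ᵥ P.mulVec v := by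
    intro v
    rw [← hz, Matrix.star_mulVec, h1, Matrix.dotProduct_mulVec]
  have hzz : P.mulVec z = z := by
    rw [← hz, Matrix.mulVec_mulVec, h2]
  have e1 : star z ⬝ᵥ z = star y ⬝ᵥ z := by rw [a, hzz]
  have e2 : star z ⬝ᵥ y = star y ⬝ᵥ z := by rw [a, hz]
  have e3 : star (y - z) ⬝ᵥ (y - z) = star y ⬝ᵥ y - star z ⬝ᵥ z := by
    rw [star_sub, sub_dotProduct, dotProduct_sub, dotProduct_sub, e2, e1]
    ring
  have h : 0 < star (y - z) ⬝ᵥ (y - z) :=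
    Matrix.dotProduct_star_self_pos_iff.mpr (sub_ne_zero.mpr hne)
  rw [e3] at h
  have := (Complex.lt_def.mp h).1
  simp only [Complex.zero_re, Complex.sub_re] at this
  linarith

/-- (Ben-Israel) Let `Q = U D U*` be Hermitian positive definite with `U` unitary and `D`
diagonal with positive entries `d i`, let `A` be an `m × n` matrix and `b ∈ ℂ^m` with
`S = {x : A x = b}` nonempty. Then minimizing `⟨x, Q x⟩` over `S` has the unique solution
`x̂ = U D^(-1/2) (A U D^(-1/2))† b`. -/
theorem stmt_7 {m n : ℕ} (Q U : Matrix (Fin n) (Fin n) ℂ) (d : Fin n → ℝ)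
    (hQ : Q.PosDef) (hU : U * Uᴴ = 1 ∧ Uᴴ * U = 1) (hd : ∀ i, 0 < d i)
    (hQdec : Q = U * Matrix.diagonal (fun i => (d i : ℂ)) * Uᴴ)
    (A : Matrix (Fin m) (Fin n) ℂ) (b : Fin m → ℂ) (hS : ∃ x, A.mulVec x = b)
    (Bd : Matrix (Fin n) (Fin m) ℂ)
    (hBd : (A * U * Matrix.diagonal
        (fun i => ((Real.sqrt (d i))⁻¹ : ℂ))).IsMoorePenroseInverse Bd) :
    letI xhat := (U * Matrix.diagonal
        (fun i => ((Real.sqrt (d i))⁻¹ : ℂ))).mulVec (Bd.mulVec b)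
    A.mulVec xhat = b ∧
      ∀ x : Fin n → ℂ, A.mulVec x = b → x ≠ xhat →
        (star xhat ⬝ᵥ Q.mulVec xhat).re < (star x ⬝ᵥ Q.mulVec x).re := by
  obtain ⟨p1, p2, p3, p4⟩ := hBd
  obtain ⟨u1, u2⟩ := hU
  have hs : ∀ i, ((Real.sqrt (d i) : ℝ) : ℂ) ≠ 0 := fun i => by
    exact_mod_cast (Real.sqrt_pos.mpr (hd i)).ne'
  set E := Matrix.diagonal (fun i => ((Real.sqrt (d i))⁻¹ : ℂ)) with hE
  obtain ⟨F, hF⟩ : ∃ F, F = Matrix.diagonal (fun i => ((Real.sqrt (d i) : ℝ) : ℂ)) := ⟨_, rfl⟩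
  have hEF : E * F = 1 := by
    rw [hE, hF, Matrix.diagonal_mul_diagonal, ← Matrix.diagonal_one]
    congr 1; funext i; exact inv_mul_cancel₀ (hs i)
  have hFE : F * E = 1 := by
    rw [hE, hF, Matrix.diagonal_mul_diagonal, ← Matrix.diagonal_one]
    congr 1; funext i; exact mul_inv_cancel₀ (hs i)
  have hFF : Fᴴ * F = Matrix.diagonal (fun i => (d i : ℂ)) := by
    rw [hF, Matrix.diagonal_conjTranspose, Matrix.diagonal_mul_diagonal]
    congr 1; funext i
    simp only [Pi.star_apply, RCLike.star_def, Complex.conj_ofReal]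
    rw [← Complex.ofReal_mul, Real.mul_self_sqrt (hd i).le]
  have hWV : (U * E) * (F * Uᴴ) = 1 := by
    rw [Matrix.mul_assoc, ← Matrix.mul_assoc E, hEF, Matrix.one_mul, u1]
  have hVW : (F * Uᴴ) * (U * E) = 1 := by
    rw [Matrix.mul_assoc, ← Matrix.mul_assoc Uᴴ, u2, Matrix.one_mul, hFE]
  have hQV : Q = (F * Uᴴ)ᴴ * (F * Uᴴ) := by
    rw [hQdec, ← hFF, Matrix.conjTranspose_mul, Matrix.conjTranspose_conjTranspose]
    simp only [Matrix.mul_assoc]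
  generalize F * Uᴴ = V at hWV hVW hQV
  rw [Matrix.mul_assoc A U E] at p1 p2 p3 p4
  generalize hx : (U * E).mulVec (Bd.mulVec b) = xhat
  generalize U * E = W at *
  have hq : ∀ x : Fin n → ℂ, star x ⬝ᵥ Q.mulVec x = star (V.mulVec x) ⬝ᵥ V.mulVec x := by
    intro x
    rw [hQV, Matrix.star_mulVec, ← Matrix.mulVec_mulVec, Matrix.dotProduct_mulVec]
  have hM : ∀ x, (A * W).mulVec (V.mulVec x) = A.mulVec x := by
    intro x
    rw [Matrix.mulVec_mulVec, Matrix.mul_assoc, hWV, Matrix.mul_one]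
  have hVx : V.mulVec xhat = Bd.mulVec b := by
    rw [← hx, Matrix.mulVec_mulVec, hVW, Matrix.one_mulVec]
  refine ⟨?_, ?_⟩
  · obtain ⟨x, h⟩ := hS
    rw [← hM, hVx, ← h, ← hM x, Matrix.mulVec_mulVec, Matrix.mulVec_mulVec, p3]
  · intro x h hne
    rw [hq, hq]
    refine proj_aux (Bd * (A * W)) p2 ?_ _ _ ?_ ?_
    · rw [← Matrix.mul_assoc (Bd * (A * W)), p4]
    · rw [hVx, ← Matrix.mulVec_mulVec, hM, h]
    · intro he
      apply hne
      have := congrArg W.mulVec he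
      simpa only [Matrix.mulVec_mulVec, hWV, Matrix.one_mulVec] using this
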